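/- Main theorem (combinatorial core): Let Γ be a finite graph and a : E(Γ) → ℕ_{>0} a tuple of positive integers. Let σ_a : H₁(Γ,ℤ) → H¹(Γ,ℤ) be γ ↦ ∑_e a_e⟨γ,e⟩[e]. Then (1 − q^{−1})^{h₁(Γ)} · |H¹(Γ,ℤ)/σ_a(H₁(Γ,ℤ))| = (1 − q^{−1})^{h₁(Γ)} · Ψ_Γ(a), i.e., the Tamagawa-type factor |H¹(Γ,ℤ)/σ_a(H₁(Γ,ℤ))| equals the Kirchhoff polynomial Ψ_Γ evaluated at the weights a. -/

import Mathlib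

/-- A finite (multi)graph: finite sets of vertices and edges with head and tail maps.
Loops and multiple edges are allowed. -/
structure FinGraph where
  V : Type
  E : Type
  [fintypeV : Fintype V]
  [fintypeE : Fintype E]
  [decEqV : DecidableEq V]
  [decEqE : DecidableEq E]
  s : E → V
  t : E → V

open Finset MeasureTheory

attribute [instance] FinGraph.fintypeV FinGraph.fintypeE FinGraph.decEqV FinGraph.decEqE

namespace FinGraph

variable (G : FinGraph)

/-- The boundary map `d : C₁(Γ,R) → C₀(Γ,R)` of the graph viewed as a CW complex. -/
noncomputable def boundary (R : Type) [CommRing R] : (G.E → R) →ₗ[R] (G.V → R) where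
  toFun γ := fun v =>
    ∑ e : G.E, γ e * ((if G.t e = v then (1 : R) else 0) - (if G.s e = v then (1 : R) else 0))
  map_add' a b := by
    funext v
    simp [add_mul, Finset.sum_add_distrib]
  map_smul' r a := by
    funext v
    simp [Finset.mul_sum, mul_assoc]

/-- The coboundary map `d* : C⁰(Γ,R) → C¹(Γ,R)`. -/
noncomputable def coboundary (R : Type) [CommRing R] : (G.V → R) →ₗ[R] (G.E → R) where
  toFun f := fun e => f (G.t e) - f (G.s e)
  map_add' a b := by funext e; simp; ring
  map_smul' r a := by funext e; simp [mul_sub]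

/-- First homology `H₁(Γ,R)`, i.e. the cycle space: the kernel of the boundary map. -/
noncomputable def H1 (R : Type) [CommRing R] : Submodule R (G.E → R) := LinearMap.ker (G.boundary R)

/-- First cohomology `H¹(Γ,R) = C¹(Γ,R)/im d*`. -/
abbrev H1Cohomology (R : Type) [CommRing R] := (G.E → R) ⧸ LinearMap.range (G.coboundary R)

/-- Pointwise rescaling of cochains by a weight function `x`. -/
noncomputable def scale (R : Type) [CommRing R] (x : G.E → R) : (G.E → R) →ₗ[R] (G.E → R) where
  toFun γ := fun e => x e * γ e
  map_add' a b := by funext e; simp [mul_add]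
  map_smul' r a := by funext e; simp; ring

/-- The map `τ_x : H₁(Γ,R) → H¹(Γ,R)`, `γ ↦ ∑_e x_e ⟨γ,e⟩ [e]`. -/
noncomputable def tau (R : Type) [CommRing R] (x : G.E → R) : G.H1 R →ₗ[R] G.H1Cohomology R :=
  (LinearMap.range (G.coboundary R)).mkQ ∘ₗ (G.scale R x) ∘ₗ (G.H1 R).subtype

/-- A maximal spanning forest, characterised algebraically: a set of edges supporting no
nonzero cycle (i.e. the subgraph is a forest), whose complement has cardinality
`h₁(Γ) = rank H₁(Γ,ℤ)` (i.e. the forest has the maximal number `|V| - c(Γ)` of edges). -/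
def IsMaxForest (T : Finset G.E) : Prop :=
  (∀ γ : G.E → ℤ, G.boundary ℤ γ = 0 → (∀ e, e ∉ T → γ e = 0) → γ = 0) ∧
    Tᶜ.card = Module.finrank ℤ (G.H1 ℤ)

open Classical in
/-- The Kirchhoff polynomial `Ψ_Γ = ∑_{T ∈ Arb(Γ)} ∏_{e ∉ T} x_e` evaluated at `x`. -/
noncomputable def kirchhoff (R : Type) [CommSemiring R] (x : G.E → R) : R :=
  ∑ T ∈ Finset.univ.filter (fun T : Finset G.E => G.IsMaxForest T), ∏ e ∈ Tᶜ, x e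

/-- Deletion `Γ ∖ e` of an edge. -/
def deleteEdge (e : G.E) : FinGraph where
  V := G.V
  E := {e' : G.E // e' ≠ e}
  s := fun e' => G.s e'.1
  t := fun e' => G.t e'.1

/-- Contraction `Γ / e` of an edge: the two endpoints of `e` are identified
(the vertex `s e` is redirected to `t e`), and `e` is removed. -/
def contractEdge (e : G.E) : FinGraph where
  V := G.V
  E := {e' : G.E // e' ≠ e}
  s := fun e' => if G.s e'.1 = G.s e then G.t e else G.s e'.1
  t := fun e' => if G.t e'.1 = G.s e then G.t e else G.t e'.1

/-- `e` is a loop if its two endpoints coincide. -/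
def IsLoop (e : G.E) : Prop := G.s e = G.t e

/-- Two vertices are adjacent if some edge joins them. -/
def Adj (u v : G.V) : Prop := ∃ e : G.E, (G.s e = u ∧ G.t e = v) ∨ (G.s e = v ∧ G.t e = u)

/-- Connectivity in the graph. -/
def Reachable (u v : G.V) : Prop := Relation.ReflTransGen G.Adj u v

/-- `e` is a bridge if after deleting `e` its endpoints are no longer connected. -/
def IsBridge (e : G.E) : Prop := ¬ (G.deleteEdge e).Reachable (G.s e) (G.t e)

/-- `e` is ordinary if it is neither a loop nor a bridge. -/
def IsOrdinary (e : G.E) : Prop := ¬ G.IsLoop e ∧ ¬ G.IsBridge e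

/-- The number of connected components of the graph. -/
noncomputable def numComponents : ℕ := Nat.card (Quot G.Adj)

/-- The number of maximal spanning forests of the graph. -/
noncomputable def numMaxForests : ℕ := Nat.card {T : Finset G.E // G.IsMaxForest T}

end FinGraph

open scoped Matrix

namespace Matrix

variable {m n R : Type*} [Fintype m] [DecidableEq m] [Fintype n] [CommRing R]

/-- The determinant of a product of rectangular matrices, expanded over all maps between the
index types. -/
theorem det_mul_eq_sum_fun (A : Matrix m n R) (B : Matrix n m R) :
    (A * B).det = ∑ f : m → n, (∏ i, B (f i) i) * (A.submatrix id f).det := by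
  simp only [det_apply', mul_apply, Finset.prod_univ_sum, Finset.mul_sum,
    Fintype.piFinset_univ, submatrix_apply, id_eq]
  rw [Finset.sum_comm]
  refine Finset.sum_congr rfl fun f _ => Finset.sum_congr rfl fun σ _ => ?_
  rw [Finset.prod_mul_distrib]
  ring

/-- The **Cauchy–Binet formula**. The enumerations `e` of the minors are arbitrary. -/
theorem det_mul_eq_sum_minors [DecidableEq n] (A : Matrix m n R) (B : Matrix n m R)
    (e : ∀ S : {S : Finset n // S.card = Fintype.card m}, m ≃ S.1) :
    (A * B).det = ∑ S, (A.submatrix id fun i => (e S i : n)).det *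
      (B.submatrix (fun i => (e S i : n)) id).det := by
  rw [det_mul_eq_sum_fun]
  have hinj : Function.Injective
      fun p : (_ : {S : Finset n // S.card = Fintype.card m}) × Equiv.Perm m =>
        fun i => (e p.1 (p.2 i) : n) := by
    rintro ⟨S, σ⟩ ⟨S', σ'⟩ h
    have hS : ∀ (S : {S : Finset n // S.card = Fintype.card m}) (σ : Equiv.Perm m) (x : n),
        x ∈ S.1 ↔ ∃ i, (e S (σ i) : n) = x := fun S σ x =>
      ⟨fun hx => ⟨σ.symm ((e S).symm ⟨x, hx⟩), by simp⟩, by rintro ⟨i, rfl⟩; exact (e S _).2⟩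
    obtain rfl : S = S' := by
      ext x
      rw [hS S σ, hS S' σ']
      exact exists_congr fun i => by rw [show (e S (σ i) : n) = e S' (σ' i) from congrFun h i]
    obtain rfl : σ = σ' := Equiv.ext fun i =>
      (e S).injective (Subtype.ext (congrFun h i))
    rfl
  rw [← Fintype.sum_of_injective _ hinj
    (fun p => (∏ i, B (e p.1 (p.2 i)) i) * (A.submatrix id fun i => (e p.1 (p.2 i) : n)).det)
    _ ?_ fun _ => rfl, Fintype.sum_sigma]
  · refine Finset.sum_congr rfl fun S _ => ?_
    rw [det_apply' (B.submatrix _ _), Finset.mul_sum]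
    refine Finset.sum_congr rfl fun σ _ => ?_
    have := det_permute' σ (A.submatrix id fun i => (e S i : n))
    rw [submatrix_submatrix] at this
    simp only [Function.comp_def, id_eq] at this
    rw [show (A.submatrix id fun i => (e S (σ i) : n)) =
      A.submatrix (fun x => x) fun i => (e S (σ i) : n) from rfl, this]
    simp only [submatrix_apply, id_eq]
    ring
  · intro f hf
    by_cases hfi : Function.Injective f
    · exfalso
      let S : {S : Finset n // S.card = Fintype.card m} :=
        ⟨Finset.univ.image f, by rw [Finset.card_image_of_injective _ hfi, Finset.card_univ]⟩
      have hmem : ∀ i, f i ∈ S.1 := fun i => Finset.mem_image_of_mem _ (Finset.mem_univ i)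
      have hg : Function.Injective fun i => (e S).symm ⟨f i, hmem i⟩ := fun i j h =>
        hfi (congrArg Subtype.val ((e S).symm.injective h))
      exact hf ⟨⟨S, Equiv.ofBijective _ (Finite.injective_iff_bijective.mp hg)⟩, by
        funext i; simp⟩
    · obtain ⟨i, j, hij, hne⟩ := Function.not_injective_iff.mp hfi
      rw [det_zero_of_column_eq hne (fun k => by simp [hij]), mul_zero]

/-- For an injective integer matrix, the cokernel has cardinality `|det|`. -/
theorem card_quotient_range_mulVecLin (M : Matrix m m ℤ) (hM : Function.Injective M.mulVecLin) :
    Nat.card ((m → ℤ) ⧸ LinearMap.range M.mulVecLin) = M.det.natAbs := by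
  have := Submodule.natAbs_det_equiv _ (LinearEquiv.ofInjective _ hM)
  rw [← LinearMap.det_toLin', Matrix.toLin'_apply']
  exact this.symm

end Matrix

namespace Submodule

variable {V : Type*} [Fintype V] [DecidableEq V]

/-- A sublattice of `ℤ^V` spanned by differences of standard basis vectors has a projection whose
kernel it is. -/
theorem exists_projection_of_span_differences (X : Set (V → ℤ))
    (hX : ∀ x ∈ X, ∃ u v, x = Pi.single u 1 - Pi.single v 1) :
    ∃ P : (V → ℤ) →ₗ[ℤ] (V → ℤ), (∀ v ∈ span ℤ X, P v = 0) ∧ ∀ v, v - P v ∈ span ℤ X := by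
  let r : Setoid V :=
    { r := fun u v => (Pi.single u 1 - Pi.single v 1 : V → ℤ) ∈ span ℤ X
      iseqv :=
        { refl := fun u => by simp
          symm := fun {u v} h => by simpa using (span ℤ X).neg_mem h
          trans := fun {u v w} h h' => by simpa using (span ℤ X).add_mem h h' } }
  let π : V → V := fun v => (_root_.Quotient.mk r v).out
  have hπ : ∀ v, (Pi.single v 1 - Pi.single (π v) 1 : V → ℤ) ∈ span ℤ X := fun v =>
    r.symm (_root_.Quotient.exact (_root_.Quotient.out_eq (_root_.Quotient.mk r v)))
  let P : (V → ℤ) →ₗ[ℤ] (V → ℤ) := (Pi.basisFun ℤ V).constr ℤ fun v => Pi.single (π v) 1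
  have hP : ∀ v, P (Pi.single v 1) = Pi.single (π v) 1 := fun v => by
    rw [← Pi.basisFun_apply, Module.Basis.constr_basis]
  refine ⟨P, fun v hv => ?_, fun v => ?_⟩
  · have : span ℤ X ≤ LinearMap.ker P := span_le.mpr fun x hx => by
      obtain ⟨u, w, rfl⟩ := hX x hx
      have : π u = π w := congrArg _root_.Quotient.out (_root_.Quotient.sound (s := r) (subset_span hx))
      simp [hP, this]
    exact this hv
  · have hv : v = ∑ x, v x • (Pi.single x 1 : V → ℤ) := by
      simpa using ((Pi.basisFun ℤ V).sum_repr v).symm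
    rw [hv, map_sum, ← Finset.sum_sub_distrib]
    refine sum_mem fun x _ => ?_
    rw [map_smul, hP, ← smul_sub]
    exact smul_mem _ _ (hπ x)

end Submodule

namespace FinGraph

variable (G : FinGraph)

theorem boundary_single (e : G.E) :
    G.boundary ℤ (Pi.single e 1) = Pi.single (G.t e) 1 - Pi.single (G.s e) 1 := by
  funext v
  simp [boundary, Pi.single_apply, eq_comm]

theorem boundary_eq_sum (γ : G.E → ℤ) :
    G.boundary ℤ γ = ∑ e, γ e • (Pi.single (G.t e) 1 - Pi.single (G.s e) 1 : G.V → ℤ) := by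
  funext v
  simp [boundary, Pi.single_apply, eq_comm]

/-- Chains supported on `T` have a saturated image under the boundary map. -/
theorem exists_boundary_eq_of_smul (T : Finset G.E) {k : ℤ} (hk : k ≠ 0) {v : G.V → ℤ}
    {u : G.E → ℤ} (hu : ∀ e ∉ T, u e = 0) (h : k • v = G.boundary ℤ u) :
    ∃ w : G.E → ℤ, (∀ e ∉ T, w e = 0) ∧ v = G.boundary ℤ w := by
  let d : G.E → G.V → ℤ := fun e => Pi.single (G.t e) 1 - Pi.single (G.s e) 1
  obtain ⟨P, hP, hP'⟩ := Submodule.exists_projection_of_span_differences (d '' T) (by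
    rintro _ ⟨e, -, rfl⟩
    exact ⟨_, _, rfl⟩)
  have hkv : k • v ∈ Submodule.span ℤ (d '' T) := by
    rw [h, boundary_eq_sum]
    refine Submodule.sum_mem _ fun e _ => ?_
    by_cases he : e ∈ T
    · exact Submodule.smul_mem _ _ (Submodule.subset_span ⟨e, he, rfl⟩)
    · simp [hu e he]
  have hPv : P v = 0 := by
    have := hP _ hkv
    rw [map_smul] at this
    exact (smul_eq_zero.mp this).resolve_left hk
  have hv := hP' v
  rw [hPv, sub_zero, Submodule.mem_span_image_finset_iff_exists_fun] at hv
  obtain ⟨c, hc⟩ := hv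
  refine ⟨fun e => if he : e ∈ T then c ⟨e, he⟩ else 0, fun e he => dif_neg he, ?_⟩
  rw [boundary_eq_sum, ← hc, ← Finset.sum_subset (Finset.subset_univ T)
    fun e _ he => by rw [dif_neg he, zero_smul], ← Finset.sum_coe_sort T]
  exact Finset.sum_congr rfl fun i _ => by rw [dif_pos i.2]

theorem exists_boundary_section :
    ∃ s : LinearMap.range (G.boundary ℤ) →ₗ[ℤ] (G.E → ℤ), ∀ y, G.boundary ℤ (s y) = y := by
  obtain ⟨s, hs⟩ := Module.projective_lifting_property (G.boundary ℤ).rangeRestrict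
    LinearMap.id (G.boundary ℤ).surjective_rangeRestrict
  exact ⟨s, fun y => congrArg Subtype.val (LinearMap.congr_fun hs y)⟩

/-- A cochain vanishing on all cycles is a coboundary. -/
theorem mem_range_coboundary (φ : G.E → ℤ) (hφ : ∀ γ ∈ G.H1 ℤ, γ ⬝ᵥ φ = 0) :
    φ ∈ LinearMap.range (G.coboundary ℤ) := by
  let d : G.E → G.V → ℤ := fun e => Pi.single (G.t e) 1 - Pi.single (G.s e) 1
  obtain ⟨P, hP, hP'⟩ := Submodule.exists_projection_of_span_differences (Set.range d) (by
    rintro _ ⟨e, rfl⟩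
    exact ⟨_, _, rfl⟩)
  obtain ⟨s, hs⟩ := G.exists_boundary_section
  have hle : Submodule.span ℤ (Set.range d) ≤ LinearMap.range (G.boundary ℤ) :=
    Submodule.span_le.mpr (by rintro _ ⟨e, rfl⟩; exact ⟨_, G.boundary_single e⟩)
  let y : G.V → LinearMap.range (G.boundary ℤ) := fun v =>
    ⟨Pi.single v 1 - P (Pi.single v 1), hle (hP' _)⟩
  refine ⟨fun v => s (y v) ⬝ᵥ φ, funext fun e => ?_⟩
  have hcyc : s (y (G.t e)) - s (y (G.s e)) - Pi.single e 1 ∈ G.H1 ℤ := by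
    have hd : P (d e) = 0 := hP _ (Submodule.subset_span ⟨e, rfl⟩)
    simp only [d, map_sub] at hd
    rw [H1, LinearMap.mem_ker, map_sub, map_sub, hs, hs, boundary_single]
    simp only [y]
    rw [sub_eq_zero.mp hd]
    abel
  have := hφ _ hcyc
  rw [sub_dotProduct, sub_dotProduct, single_one_dotProduct, sub_eq_zero] at this
  exact this

theorem dotProduct_coboundary (γ : G.E → ℤ) (f : G.V → ℤ) :
    γ ⬝ᵥ G.coboundary ℤ f = G.boundary ℤ γ ⬝ᵥ f := by
  rw [boundary_eq_sum, sum_dotProduct]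
  simp [dotProduct, coboundary, sub_mul, Finset.sum_sub_distrib, mul_sub, Pi.single_apply]

/-- Rows are the coordinates of the vectors of a basis of the cycle lattice. -/
noncomputable def cycleMatrix :
    Matrix (Fin (Module.finrank ℤ (G.H1 ℤ))) G.E ℤ :=
  Matrix.of fun i => (Module.finBasis ℤ (G.H1 ℤ) i : G.E → ℤ)

theorem vecMul_cycleMatrix (x : Fin (Module.finrank ℤ (G.H1 ℤ)) → ℤ) :
    x ᵥ* G.cycleMatrix = ((Module.finBasis ℤ (G.H1 ℤ)).equivFun.symm x : G.E → ℤ) := by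
  funext e
  simp [Matrix.vecMul, dotProduct, cycleMatrix, Module.Basis.equivFun_symm_apply]

theorem vecMul_cycleMatrix_mem (x : Fin (Module.finrank ℤ (G.H1 ℤ)) → ℤ) :
    x ᵥ* G.cycleMatrix ∈ G.H1 ℤ := by
  rw [vecMul_cycleMatrix]
  exact Subtype.prop _

theorem exists_vecMul_cycleMatrix {γ : G.E → ℤ} (hγ : γ ∈ G.H1 ℤ) :
    ∃ x, x ᵥ* G.cycleMatrix = γ :=
  ⟨(Module.finBasis ℤ (G.H1 ℤ)).equivFun ⟨γ, hγ⟩, by rw [vecMul_cycleMatrix]; simp⟩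

theorem vecMul_cycleMatrix_eq_zero {x : Fin (Module.finrank ℤ (G.H1 ℤ)) → ℤ}
    (h : x ᵥ* G.cycleMatrix = 0) : x = 0 := by
  rw [vecMul_cycleMatrix, ZeroMemClass.coe_eq_zero] at h
  exact (LinearEquiv.map_eq_zero_iff _).mp h

theorem ker_mulVecLin_cycleMatrix :
    LinearMap.ker G.cycleMatrix.mulVecLin = LinearMap.range (G.coboundary ℤ) := by
  ext φ
  rw [LinearMap.mem_ker, Matrix.mulVecLin_apply]
  constructor
  · intro h
    refine G.mem_range_coboundary φ fun γ hγ => ?_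
    obtain ⟨x, rfl⟩ := G.exists_vecMul_cycleMatrix hγ
    rw [← Matrix.dotProduct_mulVec, h, dotProduct_zero]
  · rintro ⟨f, rfl⟩
    funext i
    have : G.boundary ℤ (G.cycleMatrix i) = 0 := (Module.finBasis ℤ (G.H1 ℤ) i).2
    rw [Matrix.mulVec, dotProduct_coboundary, this, zero_dotProduct, Pi.zero_apply]

theorem mulVecLin_cycleMatrix_surjective : Function.Surjective G.cycleMatrix.mulVecLin := by
  intro w
  obtain ⟨s, hs⟩ := G.exists_boundary_section
  let r : (G.E → ℤ) →ₗ[ℤ] G.H1 ℤ :=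
    (LinearMap.id - s ∘ₗ (G.boundary ℤ).rangeRestrict).codRestrict (G.H1 ℤ) fun γ => by
      rw [H1, LinearMap.mem_ker]
      simp [hs]
  have hr : ∀ γ : G.H1 ℤ, r γ = γ := fun γ => by
    have h0 : (G.boundary ℤ).rangeRestrict γ = 0 := Subtype.ext γ.2
    ext1
    simp [r, h0]
  let l : (G.E → ℤ) →ₗ[ℤ] ℤ := (Module.finBasis ℤ (G.H1 ℤ)).constr ℤ w ∘ₗ r
  refine ⟨fun e => l (Pi.single e 1), funext fun i => ?_⟩
  have hl : ∀ γ : G.E → ℤ, γ ⬝ᵥ (fun e => l (Pi.single e 1)) = l γ := fun γ => by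
    conv_rhs => rw [← (Pi.basisFun ℤ G.E).sum_repr γ]
    simp only [map_sum, map_smul, Pi.basisFun_apply, Pi.basisFun_repr, smul_eq_mul, dotProduct]
  rw [Matrix.mulVecLin_apply, Matrix.mulVec, hl]
  simp only [l, LinearMap.comp_apply, cycleMatrix, Matrix.of_apply]
  rw [hr, Module.Basis.constr_basis]

theorem mulVec_weighted_cycleMatrix (a : G.E → ℤ) (x : Fin (Module.finrank ℤ (G.H1 ℤ)) → ℤ) :
    (G.cycleMatrix * (Matrix.diagonal a * G.cycleMatrixᵀ)) *ᵥ x =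
      G.cycleMatrix *ᵥ G.scale ℤ a (x ᵥ* G.cycleMatrix) := by
  rw [← Matrix.mulVec_mulVec, ← Matrix.mulVec_mulVec, Matrix.mulVec_transpose]
  congr 1
  funext e
  rw [Matrix.mulVec_diagonal]
  rfl

theorem mulVecLin_weighted_cycleMatrix_injective (a : G.E → ℤ) (ha : ∀ e, 0 < a e) :
    Function.Injective (G.cycleMatrix * (Matrix.diagonal a * G.cycleMatrixᵀ)).mulVecLin := by
  rw [← LinearMap.ker_eq_bot, LinearMap.ker_eq_bot']
  intro x hx
  rw [Matrix.mulVecLin_apply, mulVec_weighted_cycleMatrix] at hx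
  have h := congrArg (x ⬝ᵥ ·) hx
  simp only [Matrix.dotProduct_mulVec, dotProduct_zero] at h
  have hterm : ∀ e ∈ Finset.univ, 0 ≤ (x ᵥ* G.cycleMatrix) e *
      G.scale ℤ a (x ᵥ* G.cycleMatrix) e := fun e _ => by
    have : (x ᵥ* G.cycleMatrix) e * G.scale ℤ a (x ᵥ* G.cycleMatrix) e =
      a e * (x ᵥ* G.cycleMatrix) e ^ 2 := by simp only [scale, LinearMap.coe_mk, AddHom.coe_mk]; ring
    rw [this]
    have := (ha e).le
    positivity
  rw [dotProduct, Finset.sum_eq_zero_iff_of_nonneg hterm] at h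
  refine G.vecMul_cycleMatrix_eq_zero (funext fun e => ?_)
  have he := h e (Finset.mem_univ e)
  simpa [scale, (ha e).ne'] using he

theorem card_coker_tau (a : G.E → ℤ) (ha : ∀ e, 0 < a e) :
    Nat.card (G.H1Cohomology ℤ ⧸ LinearMap.range (G.tau ℤ a)) =
      (G.cycleMatrix * (Matrix.diagonal a * G.cycleMatrixᵀ)).det.natAbs := by
  rw [← Matrix.card_quotient_range_mulVecLin _ (G.mulVecLin_weighted_cycleMatrix_injective a ha)]
  let q : G.H1Cohomology ℤ ≃ₗ[ℤ] (Fin (Module.finrank ℤ (G.H1 ℤ)) → ℤ) :=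
    (Submodule.quotEquivOfEq _ _ G.ker_mulVecLin_cycleMatrix.symm).trans
      (G.cycleMatrix.mulVecLin.quotKerEquivOfSurjective G.mulVecLin_cycleMatrix_surjective)
  have hq : ∀ φ : G.E → ℤ, q (Submodule.Quotient.mk φ) = G.cycleMatrix *ᵥ φ := fun φ => rfl
  refine Nat.card_congr (Submodule.Quotient.equiv _ _ q ?_).toEquiv
  ext y
  constructor
  · rintro ⟨_, ⟨γ, rfl⟩, rfl⟩
    obtain ⟨x, hx⟩ := G.exists_vecMul_cycleMatrix γ.2
    refine ⟨x, ?_⟩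
    rw [Matrix.mulVecLin_apply, mulVec_weighted_cycleMatrix, hx, ← hq]
    rfl
  · rintro ⟨x, rfl⟩
    refine ⟨_, ⟨⟨_, G.vecMul_cycleMatrix_mem x⟩, rfl⟩, ?_⟩
    rw [Matrix.mulVecLin_apply, mulVec_weighted_cycleMatrix, ← hq]
    rfl

open Classical in
/-- The maximal minors of the cycle matrix are `0` or `±1`, the latter exactly for complements of
maximal spanning forests. -/
theorem sq_det_cycleMatrix_minor (S : Finset G.E)
    (e : Fin (Module.finrank ℤ (G.H1 ℤ)) ≃ S) :
    (G.cycleMatrix.submatrix id fun i => (e i : G.E)).det ^ 2 =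
      if G.IsMaxForest Sᶜ then 1 else 0 := by
  set B := G.cycleMatrix.submatrix id fun i => (e i : G.E)
  have hres : ∀ γ γ' : G.E → ℤ, (∀ i, γ (e i) = γ' (e i)) ↔ ∀ f ∈ S, γ f = γ' f := fun γ γ' =>
    ⟨fun h f hf => by simpa using h (e.symm ⟨f, hf⟩), fun h i => h _ (e i).2⟩
  have hcard : S.card = Module.finrank ℤ (G.H1 ℤ) := by
    simpa using (Fintype.card_congr e).symm
  split_ifs with hF
  · refine Int.isUnit_sq ?_
    rw [← Matrix.isUnit_iff_isUnit_det, ← Matrix.vecMul_surjective_iff_isUnit]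
    have hdet : B.det ≠ 0 := by
      intro h0
      obtain ⟨x, hx, hxB⟩ := Matrix.exists_vecMul_eq_zero_iff.mpr h0
      refine hx (G.vecMul_cycleMatrix_eq_zero (hF.1 _ (G.vecMul_cycleMatrix_mem x) ?_))
      intro f hf
      exact (hres (x ᵥ* G.cycleMatrix) 0).mp (fun i => congrFun hxB i) f (by simpa using hf)
    intro w
    let w' : G.E → ℤ := fun f => if hf : f ∈ S then w (e.symm ⟨f, hf⟩) else 0
    have hw' : ∀ i, w' (e i) = w i := fun i => by simp [w']
    have hx : (w ᵥ* B.adjugate) ᵥ* B = B.det • w := by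
      rw [Matrix.vecMul_vecMul, Matrix.adjugate_mul, Matrix.vecMul_smul, Matrix.vecMul_one]
    set γ := (w ᵥ* B.adjugate) ᵥ* G.cycleMatrix
    have hγ : G.boundary ℤ γ = 0 := G.vecMul_cycleMatrix_mem _
    have hγS : ∀ f ∈ S, γ f = (B.det • w') f := (hres _ _).mp fun i => by
      rw [Pi.smul_apply, hw']
      exact congrFun hx i
    obtain ⟨u, hu, hbu⟩ := G.exists_boundary_eq_of_smul Sᶜ hdet (v := G.boundary ℤ w')
      (u := B.det • w' - γ) (fun f hf => by
        rw [Pi.sub_apply, hγS f (by simpa using hf), sub_self])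
      (by rw [map_sub, hγ, sub_zero, map_smul])
    obtain ⟨x, hx'⟩ := G.exists_vecMul_cycleMatrix (γ := w' - u) (by
      rw [H1, LinearMap.mem_ker, map_sub, hbu, sub_self])
    refine ⟨x, funext fun i => ?_⟩
    change (x ᵥ* G.cycleMatrix) (e i) = w i
    rw [hx', Pi.sub_apply, hw', hu _ (by simp), sub_zero]
  · have : ∃ γ : G.E → ℤ, G.boundary ℤ γ = 0 ∧ (∀ f ∉ Sᶜ, γ f = 0) ∧ γ ≠ 0 := by
      by_contra! h
      exact hF ⟨h, by rw [compl_compl, hcard]⟩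
    obtain ⟨γ, hγ, hγS, hne⟩ := this
    obtain ⟨x, rfl⟩ := G.exists_vecMul_cycleMatrix hγ
    rw [sq_eq_zero_iff, ← Matrix.exists_vecMul_eq_zero_iff]
    refine ⟨x, fun h => hne (by rw [h, Matrix.zero_vecMul]), funext fun i => ?_⟩
    exact hγS _ (by simp)

/-- The weighted matrix-forest theorem for the cycle lattice. -/
theorem det_weighted_cycleMatrix (a : G.E → ℤ) :
    (G.cycleMatrix * (Matrix.diagonal a * G.cycleMatrixᵀ)).det = G.kirchhoff ℤ a := by
  classical
  let e : ∀ S : {S : Finset G.E // S.card = Fintype.card (Fin (Module.finrank ℤ (G.H1 ℤ)))},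
      Fin (Module.finrank ℤ (G.H1 ℤ)) ≃ S.1 := fun S =>
    Fintype.equivOfCardEq (by rw [Fintype.card_coe, S.2])
  rw [Matrix.det_mul_eq_sum_minors _ _ e, kirchhoff, Finset.sum_filter]
  refine Fintype.sum_of_injective (fun S => S.1ᶜ)
    (fun S S' h => Subtype.ext (compl_injective h)) _ _ (fun T hT => if_neg fun hF => ?_)
    fun S => ?_
  · exact hT ⟨⟨Tᶜ, by simpa using hF.2⟩, compl_compl T⟩
  · have hmul : (Matrix.diagonal a * G.cycleMatrixᵀ).submatrix (fun i => (e S i : G.E)) id =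
        Matrix.diagonal (fun i => a (e S i)) *
          (G.cycleMatrix.submatrix id fun i => (e S i : G.E))ᵀ := by
      ext i j
      simp [Matrix.diagonal_mul]
    have hprod : ∏ i, a (e S i) = ∏ f ∈ S.1, a f := by
      rw [(e S).prod_comp fun f => a f, Finset.prod_coe_sort S.1 a]
    rw [hmul, Matrix.det_mul, Matrix.det_diagonal, Matrix.det_transpose, hprod, mul_left_comm,
      ← sq, sq_det_cycleMatrix_minor, compl_compl]
    simp

theorem kirchhoff_nonneg (a : G.E → ℤ) (ha : ∀ e, 0 ≤ a e) : 0 ≤ G.kirchhoff ℤ a :=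
  Finset.sum_nonneg fun _ _ => Finset.prod_nonneg fun e _ => ha e

end FinGraph

/-- Combinatorial core of the main theorem: for positive integer weights `a`, the
Tamagawa-type factor `|H¹(Γ,ℤ)/σ_a(H₁(Γ,ℤ))|` equals the Kirchhoff polynomial `Ψ_Γ`
evaluated at the weights `a`; consequently
`(1 − q⁻¹)^{h₁(Γ)} · |H¹(Γ,ℤ)/σ_a(H₁(Γ,ℤ))| = (1 − q⁻¹)^{h₁(Γ)} · Ψ_Γ(a)`. -/
theorem tamagawa_eq_kirchhoff (G : FinGraph) (a : G.E → ℤ) (ha : ∀ e, 0 < a e) :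
    (Nat.card (G.H1Cohomology ℤ ⧸ LinearMap.range (G.tau ℤ a)) : ℤ) = G.kirchhoff ℤ a ∧
    ∀ q : ℝ, (1 - q⁻¹) ^ (Module.finrank ℤ (G.H1 ℤ)) *
        (Nat.card (G.H1Cohomology ℤ ⧸ LinearMap.range (G.tau ℤ a)) : ℝ) =
      (1 - q⁻¹) ^ (Module.finrank ℤ (G.H1 ℤ)) * (G.kirchhoff ℤ a : ℝ) := by
  have h : (Nat.card (G.H1Cohomology ℤ ⧸ LinearMap.range (G.tau ℤ a)) : ℤ) = G.kirchhoff ℤ a := by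
    rw [G.card_coker_tau a ha, G.det_weighted_cycleMatrix,
      Int.natAbs_of_nonneg (G.kirchhoff_nonneg a fun e => (ha e).le)]
  refine ⟨h, fun q => ?_⟩
  rw [← h, Int.cast_natCast]
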